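/- Let L be the relational language with one m-ary relation symbol ρ_m for each m ≥ 1, and let 𝐀 = (A; (ρ_m)_{m≥1}) be an infinite L-structure such that: (1) Th(𝐀) is ω-categorical; (2) for every m the reduct 𝐀^{[m]} = (A; ρ_1,…,ρ_m) is homogeneous; (3) 𝐀 is rigid, i.e. Aut 𝐀 = {id_A}. Let R := ⟨ρ_1, ρ_2, …⟩_{KA} be the set of first-order definable (without parameters) relations of 𝐀. Then ⟨ρ_1,…,ρ_m⟩_{KA} = sInv Aut {ρ_1,…,ρ_m} for every m, R = ⋃_m ⟨ρ_1,…,ρ_m⟩_{KA}, and R = ⟨R⟩_{inv,∩} ⊊ sInv Aut R. -/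

import Mathlib

open FirstOrder

/-- A finitary relation on `A` of arity `m+1` (so all arities are ≥ 1). -/
def Rels (A : Type*) : Type _ := Σ m : ℕ, Set (Fin (m + 1) → A)

/-- The image `g[ρ]` of a relation under a permutation. -/
def permImage {A : Type*} (g : Equiv.Perm A) {m : ℕ} (ρ : Set (Fin m → A)) :
    Set (Fin m → A) := (fun a => ⇑g ∘ a) '' ρ

/-- `Aut R`: permutations strongly preserving every relation in `R`. -/
def AutR {A : Type*} (R : Set (Rels A)) : Set (Equiv.Perm A) :=
  {g | ∀ ρ ∈ R, permImage g ρ.2 = ρ.2}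

/-- `sInv G`: relations strongly invariant under every permutation in `G`. -/
def sInvG {A : Type*} (G : Set (Equiv.Perm A)) : Set (Rels A) :=
  {ρ | ∀ g ∈ G, permImage g ρ.2 = ρ.2}

/-- The language with relation symbols `P i` of arity `k i`, for `i : Fin n`. -/
def relLang (n : ℕ) (k : Fin n → ℕ) : Language where
  Functions := fun _ => Empty
  Relations := fun m => {i : Fin n // k i = m}

/-- The structure on `A` interpreting `P i` as `ρ i`. -/
def relStruct {A : Type*} {n : ℕ} {k : Fin n → ℕ}
    (ρ : ∀ i : Fin n, Set (Fin (k i) → A)) : (relLang n k).Structure A where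
  funMap := fun f _ => f.elim
  RelMap := fun {m} r x => (fun j => x (Fin.cast r.2 j)) ∈ ρ r.1

/-- The logical operation given by a first-order formula `φ` with `m` free
variables, applied to the relations `ρ i`. -/
def logicalOp {A : Type*} {n : ℕ} {k : Fin n → ℕ}
    (ρ : ∀ i : Fin n, Set (Fin (k i) → A)) {m : ℕ}
    (φ : (relLang n k).Formula (Fin m)) : Set (Fin m → A) :=
  letI := relStruct ρ
  {a | φ.Realize a}

/-- `R` is closed under all logical operations (i.e. `R` is a Krasner algebra). -/
def KrasnerClosed {A : Type*} (R : Set (Rels A)) : Prop :=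
  ∀ (n : ℕ) (k : Fin n → ℕ) (ρ : ∀ i : Fin n, Set (Fin (k i + 1) → A)),
    (∀ i, (⟨k i, ρ i⟩ : Rels A) ∈ R) →
    ∀ (m : ℕ) (φ : (relLang n (fun i => k i + 1)).Formula (Fin (m + 1))),
      (⟨m, logicalOp ρ φ⟩ : Rels A) ∈ R

/-- `R` is ∩-closed: it contains each `A^m` and is closed under arbitrary
intersections of relations of equal arity. -/
def InterClosed {A : Type*} (R : Set (Rels A)) : Prop :=
  (∀ m : ℕ, (⟨m, Set.univ⟩ : Rels A) ∈ R) ∧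
  ∀ (m : ℕ) (Q : Set (Set (Fin (m + 1) → A))),
    (∀ ρ ∈ Q, (⟨m, ρ⟩ : Rels A) ∈ R) → (⟨m, ⋂₀ Q⟩ : Rels A) ∈ R

/-- `⟨Q⟩_{KA}`: the Krasner algebra generated by `Q`. -/
def KAClosure {A : Type*} (Q : Set (Rels A)) : Set (Rels A) :=
  ⋂₀ {R | Q ⊆ R ∧ KrasnerClosed R}

/-- `f` (restricted to `s`) is a partial automorphism of `Q`. -/
def IsPartialAuto {A : Type*} (Q : Set (Rels A)) (s : Set A) (f : A → A) : Prop :=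
  Set.InjOn f s ∧ ∀ ρ ∈ Q, ∀ a : Fin ((Sigma.fst ρ) + 1) → A,
    (∀ i, a i ∈ s) → (a ∈ ρ.2 ↔ f ∘ a ∈ ρ.2)

/-- `Q` is homogeneous: every finite partial automorphism of `Q` extends to an
automorphism of `Q`. -/
def Homogeneous {A : Type*} (Q : Set (Rels A)) : Prop :=
  ∀ (s : Set A), s.Finite → ∀ f : A → A, IsPartialAuto Q s f →
    ∃ g ∈ AutR Q, ∀ x ∈ s, g x = f x

/-- An invariant (finitary) operation on relations. -/
def Invariant {A : Type*} {n : ℕ} {k : Fin n → ℕ} {m : ℕ}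
    (F : (∀ i : Fin n, Set (Fin (k i + 1) → A)) → Set (Fin (m + 1) → A)) : Prop :=
  ∀ (g : Equiv.Perm A) (ρ : ∀ i : Fin n, Set (Fin (k i + 1) → A)),
    F (fun i => permImage g (ρ i)) = permImage g (F ρ)

/-- `R` is closed under all invariant (finitary) operations. -/
def InvClosed {A : Type*} (R : Set (Rels A)) : Prop :=
  ∀ (n : ℕ) (k : Fin n → ℕ) (m : ℕ)
    (F : (∀ i : Fin n, Set (Fin (k i + 1) → A)) → Set (Fin (m + 1) → A)),
    Invariant F → ∀ ρ : ∀ i : Fin n, Set (Fin (k i + 1) → A),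
      (∀ i, (⟨k i, ρ i⟩ : Rels A) ∈ R) → (⟨m, F ρ⟩ : Rels A) ∈ R

/-- `⟨Q⟩_{inv,∩}`: the least ∩-closed set containing `Q` and closed under all
invariant operations. -/
def invInterClosure {A : Type*} (Q : Set (Rels A)) : Set (Rels A) :=
  ⋂₀ {R | Q ⊆ R ∧ InvClosed R ∧ InterClosed R}

/-- The language with exactly one relation symbol of arity `m` for each
`m ≥ 1` (the symbol of arity `k+1` is recorded by the witness `k`). -/
def Lrel : Language where
  Functions := fun _ => Empty
  Relations := fun m => {k : ℕ // k + 1 = m}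

/-- The `Lrel`-structure on `A` interpreting the `(k+1)`-ary symbol as `ρ k`. -/
def LrelStruct {A : Type*} (ρ : ∀ k : ℕ, Set (Fin (k + 1) → A)) :
    Lrel.Structure A where
  funMap := fun f _ => f.elim
  RelMap := fun {m} r x => (fun j => x (Fin.cast r.2 j)) ∈ ρ r.1
/-- `Th(A; (ρ_k)_k)` is ω-categorical: it has, up to isomorphism, exactly one
countable model. -/
def OmegaCategoricalTh {A : Type} (ρ : ∀ k : ℕ, Set (Fin (k + 1) → A)) : Prop :=
  letI := LrelStruct ρ
  (∃ M : Language.Theory.ModelType.{0, 0, 0} (Lrel.completeTheory A), Cardinal.mk M = Cardinal.aleph0) ∧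
  Cardinal.Categorical.{0, 0, 0} Cardinal.aleph0 (Lrel.completeTheory A)


namespace RN
open FirstOrder FirstOrder.Language Cardinal

variable {L : FirstOrder.Language.{0, 0}}

/-- M is the unique countable model of its theory. -/
def Uniq (L : FirstOrder.Language.{0, 0}) (M : Type) [L.Structure M] : Prop :=
  ∀ (N : Type) [L.Structure N] [Nonempty N], N ⊨ L.completeTheory M → #N = ℵ₀ →
    Nonempty (M ≃[L] N)

theorem realize_of_fin (hL : L.card ≤ ℵ₀) {M : Type} [L.Structure M] [Infinite M]
    (hM : Uniq L M) {n : ℕ} (Γ : Set (L.Formula (Fin n)))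
    (h : ∀ F : Finset (L.Formula (Fin n)), (↑F : Set _) ⊆ Γ →
      ∃ v : Fin n → M, ∀ φ ∈ F, φ.Realize v) :
    ∃ v : Fin n → M, ∀ φ ∈ Γ, φ.Realize v := by
  classical
  let T : L[[Fin n]].Theory := (L.lhomWithConstants (Fin n)).onTheory (L.completeTheory M) ∪
    Formula.equivSentence '' Γ
  have hT : T.IsSatisfiable := by
    rw [Theory.isSatisfiable_iff_isFinitelySatisfiable]
    intro T0 hT0
    obtain ⟨v, hv⟩ := h ((T0.image Formula.equivSentence.symm).filter (· ∈ Γ))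
      (by intro φ hφ; simp at hφ; exact hφ.2)
    letI : (constantsOn (Fin n)).Structure M := constantsOn.structure v
    have : M ⊨ (T0 : L[[Fin n]].Theory) := by
      refine ⟨fun φ hφ => ?_⟩
      rcases hT0 hφ with h1 | ⟨ψ, hψ, rfl⟩
      · have : M ⊨ (L.lhomWithConstants (Fin n)).onTheory (L.completeTheory M) :=
          (LHom.onTheory_model _ _).2 inferInstance
        exact this.realize_of_mem φ h1
      · rw [Formula.realize_equivSentence]
        refine hv ψ ?_
        simp only [Finset.mem_filter, Finset.mem_image]
        exact ⟨⟨_, hφ, by simp⟩, hψ⟩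
    exact Theory.Model.isSatisfiable M
  obtain ⟨N⟩ := hT
  letI : L.Structure N := (L.lhomWithConstants (Fin n)).reduct N
  have hN1 : N ⊨ L.completeTheory M := by
    refine (LHom.onTheory_model (L.lhomWithConstants (Fin n)) _).1 ?_
    exact N.is_model.mono Set.subset_union_left
  have hN2 : ∀ φ ∈ Γ, φ.Realize (fun a => (L.con a : N)) := by
    intro φ hφ
    rw [← Formula.realize_equivSentence]
    exact N.is_model.realize_of_mem _ (Or.inr ⟨φ, hφ, rfl⟩)
  have hinf : Infinite N := by
    have e : M ≅[L] N := by
      rw [elementarilyEquivalent_iff]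
      intro φ
      exact (realize_iff_of_model_completeTheory M N φ).symm
    exact e.infinite
  obtain ⟨S, hS1, hS2⟩ := exists_elementarySubstructure_card_eq.{0,0,0,0} L
    (Set.range (fun a : Fin n => (L.con a : N))) ℵ₀ le_rfl
    (by simpa using Set.Countable.le_aleph0 (Set.countable_range _)) (by simpa using hL)
    (by simp)
  have hS3 : #S = ℵ₀ := by simpa using hS2
  have hSne : Nonempty S := by
    rw [← mk_ne_zero_iff, hS3]; exact aleph0_ne_zero
  obtain ⟨e⟩ := hM S (S.theory_model_iff _ |>.2 hN1) hS3
  let w : Fin n → S := fun a => ⟨L.con a, hS1 ⟨a, rfl⟩⟩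
  refine ⟨e.symm ∘ w, fun φ hφ => ?_⟩
  rw [StrongHomClass.realize_formula]
  rw [← S.subtype.map_formula]
  exact hN2 φ hφ

def Iso {M : Type} [L.Structure M] {n : ℕ} (a : Fin n → M) : Prop :=
  ∃ θ : L.Formula (Fin n), θ.Realize a ∧ ∀ ψ : L.Formula (Fin n), ψ.Realize a →
    ∀ c : Fin n → M, θ.Realize c → ψ.Realize c

theorem Iso.of_elem {M N : Type} [L.Structure M] [L.Structure N] (j : M ↪ₑ[L] N) {n : ℕ}
    {a : Fin n → M} (h : Iso (L := L) (j ∘ a)) : Iso (L := L) a := by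
  obtain ⟨θ, h1, h2⟩ := h
  refine ⟨θ, (j.map_formula _ _).1 h1, fun ψ hψ c hc => ?_⟩
  exact (j.map_formula _ _).1 (h2 ψ ((j.map_formula _ _).2 hψ) _ ((j.map_formula _ _).2 hc))

theorem Iso.comp {M : Type} [L.Structure M] {n s : ℕ} {a : Fin s → M}
    (h : Iso (L := L) a) (f : Fin n → Fin s) : Iso (L := L) (a ∘ f) := by
  obtain ⟨θ, h1, h2⟩ := h
  have hd : (∅ : Set M).Definable L ((fun g : Fin s → M => g ∘ f) '' {x | θ.Realize x}) :=
    Set.Definable.image_comp (Set.empty_definable_iff.2 ⟨θ, rfl⟩) f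
  obtain ⟨η, hη⟩ := Set.empty_definable_iff.1 hd
  have key : ∀ c, η.Realize c ↔ ∃ x, θ.Realize x ∧ x ∘ f = c := fun c => by
    have : c ∈ ((fun g : Fin s → M => g ∘ f) '' {x | θ.Realize x}) ↔ η.Realize c := by
      rw [hη]; rfl
    rw [← this]; rfl
  refine ⟨η, (key _).2 ⟨a, h1, rfl⟩, fun ψ hψ c hc => ?_⟩
  obtain ⟨x, hx, rfl⟩ := (key _).1 hc
  have := h2 (ψ.relabel f) (by rw [Formula.realize_relabel]; exact hψ) x hx
  rwa [Formula.realize_relabel] at this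

theorem dense (hL : L.card ≤ ℵ₀) {M : Type} [L.Structure M] [Infinite M] [Countable M]
    (hM : Uniq L M) {n : ℕ} (φ : L.Formula (Fin n)) (a₀ : Fin n → M) (h₀ : φ.Realize a₀) :
    ∃ a : Fin n → M, φ.Realize a ∧ Iso (L := L) a := by
  classical
  by_contra hcon
  push Not at hcon
  obtain ⟨enum, henum⟩ := exists_surjective_nat (Fin n → M)
  let P := {ψ : L.Formula (Fin n) // (∃ c : Fin n → M, ψ.Realize c) ∧ ∀ c : Fin n → M, ψ.Realize c → φ.Realize c}
  have step : ∀ (ψ : P) (a : Fin n → M), ∃ ψ' : P,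
      (∀ c : Fin n → M, ψ'.1.Realize c → ψ.1.Realize c) ∧ ¬ ψ'.1.Realize a := by
    rintro ⟨ψ, ⟨c, hc⟩, hψ⟩ a
    by_cases ha : ψ.Realize a
    · have := hcon a (hψ a ha)
      unfold Iso at this
      push Not at this
      obtain ⟨χ, hχ, d, hd, hd'⟩ := this ψ ha
      refine ⟨⟨ψ ⊓ ∼χ, ⟨d, ?_⟩, fun c hc => ?_⟩, fun c hc => ?_, ?_⟩
      · simp [hd, hd']
      · simp at hc; exact hψ c hc.1
      · simp at hc; exact hc.1
      · simp [hχ]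
    · exact ⟨⟨ψ, ⟨c, hc⟩, hψ⟩, fun c hc => hc, ha⟩
  choose nx hnx1 hnx2 using step
  let seq : ℕ → P := fun k => Nat.rec ⟨φ, ⟨a₀, h₀⟩, fun _ h => h⟩ (fun k ψ => nx ψ (enum k)) k
  have hseq : ∀ k, seq (k+1) = nx (seq k) (enum k) := fun k => rfl
  have hanti : ∀ i j, i ≤ j → ∀ c : Fin n → M, (seq j).1.Realize c → (seq i).1.Realize c := by
    intro i j hij
    induction hij with
    | refl => exact fun c h => h
    | step _ ih => intro c hc; rw [Nat.succ_eq_add_one, hseq] at hc; exact ih c (hnx1 _ _ c hc)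
  obtain ⟨v, hv⟩ := realize_of_fin hL hM (Set.range fun k => (seq k).1) (by
    intro F hF
    have : ∃ K, ∀ ψ ∈ F, ∃ k ≤ K, (seq k).1 = ψ := by
      clear_value seq
      induction F using Finset.induction_on with
      | empty => exact ⟨0, by simp⟩
      | insert ψ F _ ih =>
        obtain ⟨K, hK⟩ := ih (fun x hx => hF (by simp; exact Or.inr hx))
        obtain ⟨k, hk⟩ := hF (show ψ ∈ _ by simp)
        refine ⟨max K k, fun χ hχ => ?_⟩
        rcases Finset.mem_insert.1 hχ with rfl | h
        · exact ⟨k, le_max_right _ _, hk⟩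
        · obtain ⟨k', h1, h2⟩ := hK χ h
          exact ⟨k', h1.trans (le_max_left _ _), h2⟩
    obtain ⟨K, hK⟩ := this
    obtain ⟨c, hc⟩ := (seq K).2.1
    refine ⟨c, fun ψ hψ => ?_⟩
    obtain ⟨k, hk, rfl⟩ := hK ψ hψ
    exact hanti k K hk c hc)
  obtain ⟨k, rfl⟩ := henum v
  refine hnx2 (seq k) (enum k) ?_
  rw [← hseq]
  exact hv _ ⟨k+1, rfl⟩

theorem all_iso (hL : L.card ≤ ℵ₀) [L.IsRelational] {M : Type} [L.Structure M] [Infinite M] [Countable M]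
    (hM : Uniq L M) {n : ℕ} (a : Fin n → M) : Iso (L := L) a := by
  classical
  haveI hcF : Countable (Σ n, L.BoundedFormula Empty n) := by
    rw [← mk_le_aleph0_iff]
    refine BoundedFormula.card_le.trans ?_
    simp [hL]
  let Task := Σ n : ℕ, L.BoundedFormula Empty (n+1) × (Fin n → ℕ)
  haveI : ∀ n, Countable (L.BoundedFormula Empty (n+1)) := fun n =>
    Function.Injective.countable (f := fun φ => (⟨n+1, φ⟩ : Σ n, L.BoundedFormula Empty n))
      (by intro x y h; simpa using h)
  haveI : Countable Task := by infer_instance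
  haveI : Nonempty Task := ⟨⟨0, ⊥, fun i => 0⟩⟩
  obtain ⟨task, htask⟩ := exists_surjective_nat Task
  let St := Σ s : ℕ, {b : Fin s → M // Iso (L := L) b}
  -- extension of an isolated tuple satisfying a formula
  have ext : ∀ (s : ℕ) (b : Fin s → M), Iso (L := L) b → ∀ (φ : L.Formula (Fin (s+1))) (a : M),
      φ.Realize (Fin.snoc b a : Fin (s+1) → M) → ∃ a' : M, Iso (L := L) (Fin.snoc b a' : Fin (s+1) → M) ∧
        φ.Realize (Fin.snoc b a' : Fin (s+1) → M) := by
    intro s b ⟨θ, hθ, hiso⟩ φ a ha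
    -- dense gives some tuple c with φ and θ; transfer to b by isolation
    obtain ⟨c, hc, η, hη1, hη2⟩ := dense hL hM (φ ⊓ θ.relabel Fin.castSucc) (Fin.snoc b a)
      (by
        rw [Formula.realize_inf, Formula.realize_relabel]
        refine ⟨ha, ?_⟩
        convert hθ using 1
        ext i; simp)
    rw [Formula.realize_inf, Formula.realize_relabel] at hc
    have hd : (∅ : Set M).Definable L ((fun g : Fin (s+1) → M => g ∘ Fin.castSucc) '' {x | (η ⊓ φ).Realize x}) :=
      Set.Definable.image_comp (Set.empty_definable_iff.2 ⟨η ⊓ φ, rfl⟩) _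
    obtain ⟨ζ, hζ⟩ := Set.empty_definable_iff.1 hd
    have key : ∀ d, ζ.Realize d ↔ ∃ x, (η ⊓ φ).Realize x ∧ x ∘ Fin.castSucc = d := fun d => by
      have : d ∈ ((fun g : Fin (s+1) → M => g ∘ Fin.castSucc) '' {x | (η ⊓ φ).Realize x}) ↔ ζ.Realize d := by
        rw [hζ]; rfl
      rw [← this]; rfl
    have hb : ζ.Realize b := by
      by_contra hn
      have := hiso (∼ζ) (by simpa using hn) _ hc.2
      rw [Formula.realize_not] at this
      exact this ((key _).2 ⟨c, by rw [Formula.realize_inf]; exact ⟨hη1, hc.1⟩, rfl⟩)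
    obtain ⟨x, hx, hxb⟩ := (key _).1 hb
    rw [Formula.realize_inf] at hx
    have hxx : x = (Fin.snoc b (x (Fin.last s)) : Fin (s+1) → M) := by
      rw [← hxb]
      exact (Fin.snoc_init_self x).symm
    refine ⟨x (Fin.last s), ?_, ?_⟩
    · rw [← hxx]
      refine ⟨η, hx.1, fun ψ hψ d hd => hη2 ψ ?_ d hd⟩
      by_contra hn
      have := hη2 (∼ψ) (by simpa using hn) x hx.1
      rw [Formula.realize_not] at this
      exact this hψ
    · rw [← hxx]; exact hx.2
  have step : ∀ (s : ℕ) (b : {b : Fin s → M // Iso (L := L) b}) (t : Task), ∃ a' : M,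
      Iso (L := L) (Fin.snoc b.1 a' : Fin (s+1) → M) ∧
      ∀ f : Fin t.1 → Fin s, (∀ i, (f i : ℕ) = t.2.2 i) → ∀ a : M,
        t.2.1.Realize default (Fin.snoc (b.1 ∘ f) a : Fin (t.1+1) → M) →
        t.2.1.Realize default (Fin.snoc (b.1 ∘ f) a' : Fin (t.1+1) → M) := by
    rintro s ⟨b, hb⟩ ⟨k, φ, idx⟩
    by_cases hf : ∃ f : Fin k → Fin s, (∀ i, (f i : ℕ) = idx i) ∧ ∃ a : M,
        φ.Realize default (Fin.snoc (b ∘ f) a : Fin (k+1) → M)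
    · obtain ⟨f, hf, a, ha⟩ := hf
      let g : Fin (k+1) → Fin (s+1) := Fin.snoc (fun i => (f i).castSucc) (Fin.last s)
      let φ' : L.Formula (Fin (s+1)) := φ.toFormula.relabel (Sum.elim Empty.elim g)
      have hφ' : ∀ a : M, φ'.Realize (Fin.snoc b a : Fin (s+1) → M) ↔
          φ.Realize default (Fin.snoc (b ∘ f) a : Fin (k+1) → M) := by
        intro a
        rw [Formula.realize_relabel, BoundedFormula.realize_toFormula]
        have h2 : (Fin.snoc b a : Fin (s+1) → M) ∘ g = (Fin.snoc (b ∘ f) a : Fin (k+1) → M) := by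
          ext i
          refine Fin.lastCases ?_ (fun i => ?_) i <;> simp [g]
        have h1 : ((Fin.snoc b a : Fin (s+1) → M) ∘ Sum.elim Empty.elim g) ∘ Sum.inl = default :=
          Subsingleton.elim _ _
        rw [h1, ← h2]; rfl
      obtain ⟨a', h1, h2⟩ := ext s b hb φ' a ((hφ' a).2 ha)
      refine ⟨a', h1, fun f' hf' _ _ => ?_⟩
      have : f' = f := by ext i; rw [hf, hf']
      rw [this]; exact (hφ' a').1 h2
    · obtain ⟨a0⟩ : Nonempty M := inferInstance
      obtain ⟨a', h1, h2⟩ := ext s b hb ⊤ a0 (by simp)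
      exact ⟨a', h1, fun f hf' a ha => (hf ⟨f, hf', a, ha⟩).elim⟩
  choose nx hnx1 hnx2 using step
  have iso0 : Iso (L := L) (Fin.elim0 : Fin 0 → M) :=
    ⟨⊤, by simp, fun ψ hψ c _ => by rwa [Subsingleton.elim c Fin.elim0]⟩
  let B : ∀ s : ℕ, {b : Fin s → M // Iso (L := L) b} := fun s => Nat.rec ⟨Fin.elim0, iso0⟩
    (fun s b => ⟨Fin.snoc b.1 (nx s b (task s.unpair.1)), hnx1 s b _⟩) s
  let b : ℕ → M := fun s => nx s (B s) (task s.unpair.1)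
  have hB : ∀ s, (B s).1 = fun i : Fin s => b i := by
    intro s
    induction s with
    | zero => exact Subsingleton.elim _ _
    | succ s ih =>
      show (Fin.snoc (B s).1 (b s) : Fin (s+1) → M) = _
      rw [ih]
      ext i
      refine Fin.lastCases ?_ (fun i => ?_) i <;> simp
  let S : L.Substructure M := ⟨Set.range b, fun {k} f => isEmptyElim f⟩
  have hS : ∀ x : S, ∃ k, b k = x := fun x => x.2
  have bd : ∀ (k : ℕ) (idx : Fin k → ℕ), ∃ s, ∀ i, idx i < s := by
    intro k idx
    refine ⟨(∑ i, idx i) + 1, fun i => Nat.lt_succ_of_le ?_⟩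
    exact Finset.single_le_sum (f := idx) (fun _ _ => Nat.zero_le _) (Finset.mem_univ i)
  have isoS : ∀ (k : ℕ) (x : Fin k → S), Iso (L := L) (fun i => (x i : M)) := by
    intro k x
    choose idx hidx using fun i => hS (x i)
    obtain ⟨s, hs⟩ := bd k idx
    have := (B s).2.comp (fun i => (⟨idx i, hs i⟩ : Fin s))
    rw [hB] at this
    convert this using 1
    ext i; exact (hidx i).symm
  let ES : L.ElementarySubstructure M := S.toElementarySubstructure (by
    intro k φ x a ha
    choose idx hidx using fun i => hS (x i)
    obtain ⟨s0, hs0⟩ := bd k idx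
    obtain ⟨t, ht⟩ := htask ⟨k, φ, idx⟩
    let s := Nat.pair t s0
    have hs : ∀ i, idx i < s := fun i => (hs0 i).trans_le (Nat.right_le_pair t s0)
    have htk : task s.unpair.1 = ⟨k, φ, idx⟩ := by rw [← ht]; simp [s]
    have := hnx2 s (B s) (task s.unpair.1)
    have hb : nx s (B s) (task s.unpair.1) = b s := rfl
    rw [hb, htk] at this
    have hx : (B s).1 ∘ (fun i => (⟨idx i, hs i⟩ : Fin s)) = (↑) ∘ x := by
      rw [hB]; ext i; exact hidx i
    have := this (fun i => ⟨idx i, hs i⟩) (fun i => rfl) a (by rw [hx]; exact ha)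
    rw [hx] at this
    exact ⟨⟨b s, s, rfl⟩, this⟩)
  have hmod : ES ⊨ L.completeTheory M := (ES.theory_model_iff _).2 inferInstance
  have hinf : Infinite ES := (ES.elementarilyEquivalent.infinite_iff).2 inferInstance
  obtain ⟨e⟩ := hM ES hmod (mk_eq_aleph0 ES)
  refine Iso.of_elem (ES.subtype.comp e.toElementaryEmbedding) ?_
  exact isoS n (fun i => e (a i))

/-- finitely many definable sets. -/
theorem fin_def (hL : L.card ≤ ℵ₀) [L.IsRelational] {M : Type} [L.Structure M] [Infinite M] [Countable M]
    (hM : Uniq L M) (n : ℕ) : {S : Set (Fin n → M) | ∃ φ : L.Formula (Fin n), S = {x | φ.Realize x}}.Finite := by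
  classical
  let Γ : Set (L.Formula (Fin n)) := {φ | ∃ θ : L.Formula (Fin n), φ = ∼θ ∧ 
    ∀ ψ : L.Formula (Fin n), ∀ a c : Fin n → M, θ.Realize a → ψ.Realize a → θ.Realize c → ψ.Realize c}
  have : ∃ F : Finset (L.Formula (Fin n)), (↑F : Set _) ⊆ Γ ∧ ∀ v : Fin n → M, ∃ φ ∈ F, ¬ φ.Realize v := by
    by_contra hcon
    push Not at hcon
    obtain ⟨v, hv⟩ := realize_of_fin hL hM Γ hcon
    obtain ⟨θ, h1, h2⟩ := all_iso hL hM v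
    have := hv (∼θ) ⟨θ, rfl, fun ψ a c ha hψ hc => ?_⟩
    · rw [Formula.realize_not] at this; exact this h1
    · refine h2 ψ ?_ c hc
      by_contra hn
      have := h2 (∼ψ) (by simpa using hn) a ha
      rw [Formula.realize_not] at this
      exact this hψ
  obtain ⟨F, hF, hcov⟩ := this
  let W : Set (L.Formula (Fin n)) → Set (Fin n → M) := fun G => {v | ∃ φ ∈ G, ¬ φ.Realize v}
  refine ((F.finite_toSet.finite_subsets).image W).subset ?_
  rintro S ⟨ψ, rfl⟩
  refine ⟨{φ | φ ∈ F ∧ ∀ v : Fin n → M, ¬ φ.Realize v → ψ.Realize v}, fun φ h => h.1, ?_⟩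
  ext v
  constructor
  · rintro ⟨φ, ⟨h1, h2⟩, h3⟩
    exact h2 v h3
  · intro hv
    obtain ⟨φ, hφ, hφv⟩ := hcov v
    refine ⟨φ, ⟨hφ, fun c hc => ?_⟩, hφv⟩
    obtain ⟨θ, rfl, hθ⟩ := hF hφ
    rw [Formula.realize_not, not_not] at hφv hc
    exact hθ ψ v c hφv hv hc

/-- Transfer to an elementarily equivalent structure. -/
theorem fin_def' {A M : Type} [L.Structure A] [L.Structure M] (h : M ⊨ L.completeTheory A) (n : ℕ)
    (hf : {S : Set (Fin n → M) | ∃ φ : L.Formula (Fin n), S = {x | φ.Realize x}}.Finite) :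
    {S : Set (Fin n → A) | ∃ φ : L.Formula (Fin n), S = {x | φ.Realize x}}.Finite := by
  classical
  have key : ∀ φ ψ : L.Formula (Fin n), ({x : Fin n → M | φ.Realize x} = {x | ψ.Realize x}) →
      ({x : Fin n → A | φ.Realize x} = {x | ψ.Realize x}) := by
    intro φ ψ he
    let σ : L.Sentence := Formula.iAlls (Fin n)
      ((φ.iff ψ : L.Formula (Fin n)).relabel (Sum.inr : Fin n → Empty ⊕ Fin n))
    have hσ : ∀ (N : Type) [L.Structure N], N ⊨ σ ↔ ∀ x : Fin n → N, φ.Realize x ↔ ψ.Realize x := by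
      intro N _
      unfold Sentence.Realize
      rw [Formula.realize_iAlls]
      refine forall_congr' fun x => ?_
      rw [Formula.realize_relabel, Formula.realize_iff]
      rfl
    have h1 : M ⊨ σ := (hσ M).2 fun x => by
      have : x ∈ {x : Fin n → M | φ.Realize x} ↔ x ∈ {x : Fin n → M | ψ.Realize x} := by rw [he]
      exact this
    have h2 := (hσ A).1 ((realize_iff_of_model_completeTheory A M σ).1 h1)
    ext x; exact h2 x
  choose! pick hpick using fun (S : Set (Fin n → M)) (hS : ∃ φ : L.Formula (Fin n), S = {x | φ.Realize x}) => hS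
  refine (hf.image (fun S => {x : Fin n → A | (pick S).Realize x})).subset ?_
  rintro S ⟨φ, rfl⟩
  refine ⟨{x | φ.Realize x}, ⟨φ, rfl⟩, ?_⟩
  exact key _ _ (hpick _ ⟨φ, rfl⟩).symm

end RN

section Helpers

theorem permImage_eq_iff {A : Type*} (g : Equiv.Perm A) {m : ℕ} (σ : Set (Fin m → A)) :
    permImage g σ = σ ↔ ∀ a : Fin m → A, (⇑g ∘ a ∈ σ ↔ a ∈ σ) := by
  have h0 : ∀ a : Fin m → A, ⇑g ∘ a ∈ permImage g σ ↔ a ∈ σ := by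
    intro a
    constructor
    · rintro ⟨b, hb, hab⟩
      have : b = a := by
        ext i; exact g.injective (congrFun hab i)
      rwa [← this]
    · intro h; exact ⟨a, h, rfl⟩
  constructor
  · intro h a
    rw [← h0 a, h]
  · intro h
    ext b
    have hb : b = ⇑g ∘ (⇑g.symm ∘ b) := by ext i; simp
    rw [hb, h0, h]

theorem sInvG_krasner {A : Type*} (G : Set (Equiv.Perm A)) : KrasnerClosed (sInvG G) := by
  intro n k ρ hρ m φ g hg
  letI := relStruct ρ
  have hg' : ∀ i, ∀ a, (⇑g ∘ a ∈ ρ i ↔ a ∈ ρ i) := fun i =>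
    (permImage_eq_iff g (ρ i)).1 (hρ i g hg)
  let e : A ≃[relLang n (fun i => k i + 1)] A :=
    { toEquiv := g
      map_fun' := fun f _ => f.elim
      map_rel' := fun {m} r x => hg' r.1 (fun j => x (Fin.cast r.2 j)) }
  refine (permImage_eq_iff _ _).2 fun a => ?_
  exact Language.StrongHomClass.realize_formula e φ (v := a)

theorem sInvG_inv {A : Type*} (G : Set (Equiv.Perm A)) : InvClosed (sInvG G) := by
  intro n k m F hF ρ hρ g hg
  have h := hF g ρ
  have h2 : (fun i => permImage g (ρ i)) = ρ := funext fun i => hρ i g hg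
  rw [h2] at h
  exact h.symm

theorem KA_min {A : Type*} {Q R : Set (Rels A)} (h : Q ⊆ R) (hR : KrasnerClosed R) :
    KAClosure Q ⊆ R := Set.sInter_subset_of_mem ⟨h, hR⟩

theorem KA_sub {A : Type*} (Q : Set (Rels A)) : Q ⊆ KAClosure Q :=
  Set.subset_sInter fun _ h => h.1

theorem KA_krasner {A : Type*} (Q : Set (Rels A)) : KrasnerClosed (KAClosure Q) := by
  intro n k ρ hρ m φ R hR
  exact hR.2 n k ρ (fun i => hρ i R hR) m φ

theorem KA_mono {A : Type*} {Q Q' : Set (Rels A)} (h : Q ⊆ Q') : KAClosure Q ⊆ KAClosure Q' :=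
  KA_min (h.trans (KA_sub _)) (KA_krasner _)

theorem definable_of_inv {A : Type} (ρ : ∀ k : ℕ, Set (Fin (k + 1) → A)) (m : ℕ)
    (hhom : Homogeneous {r : Rels A | ∃ k, k < m ∧ r = ⟨k, ρ k⟩}) (n : ℕ)
    (σ : Set (Fin (n + 1) → A))
    (hσ : (⟨n, σ⟩ : Rels A) ∈ sInvG (AutR {r : Rels A | ∃ k, k < m ∧ r = ⟨k, ρ k⟩})) :
    ∃ φ : (relLang m (fun i => (i : ℕ) + 1)).Formula (Fin (n + 1)),
      σ = logicalOp (fun i : Fin m => ρ i) φ := by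
  classical
  letI := relStruct (fun i : Fin m => ρ i)
  let I := (Σ i : Fin m, (Fin ((i : ℕ) + 1) → Fin (n + 1))) ⊕ (Fin (n + 1) × Fin (n + 1))
  let C : I → Set (Fin (n + 1) → A) := fun t =>
    Sum.elim (fun p => {a | a ∘ p.2 ∈ ρ p.1}) (fun p => {a | a p.1 = a p.2}) t
  have hC : ∀ t, (∅ : Set A).Definable (relLang m (fun i => (i : ℕ) + 1)) (C t) := by
    rintro (⟨i, f⟩ | ⟨i, j⟩)
    · rw [Set.empty_definable_iff]
      let r : (relLang m (fun i => (i : ℕ) + 1)).Relations ((i : ℕ) + 1) := ⟨i, rfl⟩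
      refine ⟨r.formula (fun j => Language.Term.var (f j)), ?_⟩
      ext a
      have : (r.formula (fun j => Language.Term.var (f j))).Realize a ↔ a ∘ f ∈ ρ i := by
        rw [Language.Formula.realize_rel]
        exact Iff.rfl
      exact this.symm
    · rw [Set.empty_definable_iff]
      refine ⟨Language.Term.equal (Language.Term.var i) (Language.Term.var j), ?_⟩
      ext a
      have : (Language.Term.equal (L := relLang m (fun i => (i : ℕ) + 1)) (Language.Term.var i)
          (Language.Term.var j)).Realize a ↔ a i = a j := by
        rw [Language.Formula.realize_equal]
        exact Iff.rfl
      exact this.symm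
  -- tuples of the same quantifier-free type
  have hsame : ∀ a b : Fin (n + 1) → A, (∀ t, a ∈ C t ↔ b ∈ C t) → a ∈ σ → b ∈ σ := by
    intro a b hab ha
    let f : A → A := fun x => if h : ∃ i, a i = x then b h.choose else x
    have hf : ∀ i, f (a i) = b i := by
      intro i
      have h : ∃ j, a j = a i := ⟨i, rfl⟩
      have h1 : f (a i) = b h.choose := dif_pos h
      rw [h1]
      exact (hab (Sum.inr (h.choose, i))).1 h.choose_spec
    have hpa : IsPartialAuto {r : Rels A | ∃ k, k < m ∧ r = ⟨k, ρ k⟩} (Set.range a) f := by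
      refine ⟨?_, ?_⟩
      · rintro _ ⟨i, rfl⟩ _ ⟨j, rfl⟩ hij
        rw [hf, hf] at hij
        exact (hab (Sum.inr (i, j))).2 hij
      · rintro _ ⟨k, hk, rfl⟩ c hc
        choose idx hidx using hc
        have h1 : c = a ∘ idx := funext fun i => (hidx i).symm
        have h2 : f ∘ c = b ∘ idx := by
          rw [h1]; exact funext fun i => hf (idx i)
        rw [h2, h1]
        exact hab (Sum.inl ⟨⟨k, hk⟩, idx⟩)
    obtain ⟨g, hg, hgf⟩ := hhom _ (Set.finite_range a) f hpa
    have h1 : ⇑g ∘ a = b := funext fun i => by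
      rw [← hf i]; exact hgf _ ⟨i, rfl⟩
    have h2 := (permImage_eq_iff g σ).1 (hσ g hg) a
    rw [h1] at h2
    exact h2.2 ha
  let cell : Set I → Set (Fin (n + 1) → A) := fun t =>
    ⋂ i : I, (if i ∈ t then C i else (C i)ᶜ)
  have hcell : ∀ t b, b ∈ cell t ↔ ∀ i, (b ∈ C i ↔ i ∈ t) := by
    intro t b
    simp only [cell, Set.mem_iInter]
    refine forall_congr' fun i => ?_
    by_cases hi : i ∈ t <;> simp [hi]
  have hcd : ∀ t, (∅ : Set A).Definable (relLang m (fun i => (i : ℕ) + 1)) (cell t) := by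
    intro t
    refine Set.definable_iInter_of_finite fun i => ?_
    split_ifs
    · exact hC i
    · exact (hC i).compl
  have hU : σ = ⋃ t : {t : Set I // ∃ a ∈ σ, a ∈ cell t}, cell t.1 := by
    ext b
    simp only [Set.mem_iUnion]
    constructor
    · intro hb
      have : b ∈ cell {i | b ∈ C i} := (hcell _ _).2 fun i => Iff.rfl
      exact ⟨⟨_, b, hb, this⟩, this⟩
    · rintro ⟨⟨t, a, ha, hat⟩, hb⟩
      exact hsame a b (fun i => ((hcell _ _).1 hat i).trans ((hcell _ _).1 hb i).symm) ha
  have hd : (∅ : Set A).Definable (relLang m (fun i => (i : ℕ) + 1)) σ := by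
    rw [hU]
    exact Set.definable_iUnion_of_finite fun t => hcd t.1
  obtain ⟨φ, hφ⟩ := Set.empty_definable_iff.1 hd
  exact ⟨φ, hφ⟩

/-- The inclusion of the finite language into `Lrel`. -/
def toLrel (m : ℕ) : relLang m (fun i => (i : ℕ) + 1) →ᴸ Lrel where
  onFunction := fun _ f => f.elim
  onRelation := fun _ r => ⟨(r.1 : ℕ), r.2⟩

theorem logicalOp_Lrel {A : Type} (ρ : ∀ k : ℕ, Set (Fin (k + 1) → A)) (m n : ℕ)
    (φ : (relLang m (fun i => (i : ℕ) + 1)).Formula (Fin n)) :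
    letI := LrelStruct ρ
    ∃ ψ : Lrel.Formula (Fin n), logicalOp (fun i : Fin m => ρ i) φ = {x | ψ.Realize x} := by
  letI := LrelStruct ρ
  letI := relStruct (fun i : Fin m => ρ i)
  haveI : (toLrel m).IsExpansionOn A :=
    { map_onFunction := fun f _ => f.elim
      map_onRelation := fun r x => rfl }
  refine ⟨(toLrel m).onFormula φ, ?_⟩
  ext x
  exact (Language.LHom.realize_onFormula (toLrel m) φ (v := x)).symm

theorem Lrel_card : Lrel.card ≤ Cardinal.aleph0 := by
  have h1 : Countable (Σ l, Lrel.Functions l) := by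
    have : ∀ l, IsEmpty (Lrel.Functions l) := fun l => inferInstanceAs (IsEmpty Empty)
    infer_instance
  have h2 : Countable (Σ l, Lrel.Relations l) := by
    have : ∀ l, Countable (Lrel.Relations l) := fun l =>
      inferInstanceAs (Countable {k : ℕ // k + 1 = l})
    infer_instance
  exact Cardinal.mk_le_aleph0_iff.2 (inferInstanceAs (Countable (_ ⊕ _)))

theorem finite_definable {A : Type} [Infinite A] (ρ : ∀ k : ℕ, Set (Fin (k + 1) → A))
    (hcat : OmegaCategoricalTh ρ) (n : ℕ) :
    letI := LrelStruct ρ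
    {S : Set (Fin n → A) | ∃ φ : Lrel.Formula (Fin n), S = {x | φ.Realize x}}.Finite := by
  letI := LrelStruct ρ
  obtain ⟨⟨M, hM⟩, hc⟩ := hcat
  haveI : Lrel.IsRelational := fun l => inferInstanceAs (IsEmpty Empty)
  haveI : Infinite M := Cardinal.aleph0_le_mk_iff.1 hM.ge
  haveI : Countable M := Cardinal.mk_le_aleph0_iff.1 hM.le
  refine RN.fin_def' (M := M) M.is_model n (RN.fin_def Lrel_card ?_ n)
  intro N _ _ hN hcard
  have hN' : N ⊨ Lrel.completeTheory A := by
    have : Lrel.completeTheory M = Lrel.completeTheory A := by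
      ext φ
      exact Language.realize_iff_of_model_completeTheory A M φ
    rwa [this] at hN
  exact hc M (Language.Theory.ModelType.of _ N) hM hcard

end Helpers

/-- Let `𝐀 = (A; (ρ_m)_{m ≥ 1})` be an infinite structure in
the language with one relation symbol of each arity `m ≥ 1` (here `ρ k` has
arity `k+1`) such that (1) `Th(𝐀)` is ω-categorical (it has, up to isomorphism,
exactly one countable model), (2) every reduct `𝐀^{[m]}` to the first `m`
relations is homogeneous, and (3) `𝐀` is rigid.  Let `R := ⟨ρ_1, ρ_2, …⟩_{KA}`.
Then `⟨ρ_1, …, ρ_m⟩_{KA} = sInv Aut {ρ_1, …, ρ_m}` for every `m`,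
`R = ⋃_m ⟨ρ_1, …, ρ_m⟩_{KA}`, and `R = ⟨R⟩_{inv,∩} ⊊ sInv Aut R`. -/
theorem stmt11 {A : Type} [Infinite A] (ρ : ∀ k : ℕ, Set (Fin (k + 1) → A))
    (hcat : OmegaCategoricalTh ρ)
    (hhom : ∀ m : ℕ, Homogeneous {r : Rels A | ∃ k, k < m ∧ r = ⟨k, ρ k⟩})
    (hrigid : AutR {r : Rels A | ∃ k, r = ⟨k, ρ k⟩} = {1}) :
    (∀ m : ℕ, KAClosure {r : Rels A | ∃ k, k < m ∧ r = ⟨k, ρ k⟩} =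
        sInvG (AutR {r : Rels A | ∃ k, k < m ∧ r = ⟨k, ρ k⟩})) ∧
    (KAClosure {r : Rels A | ∃ k, r = ⟨k, ρ k⟩} =
        ⋃ m : ℕ, KAClosure {r : Rels A | ∃ k, k < m ∧ r = ⟨k, ρ k⟩}) ∧
    (KAClosure {r : Rels A | ∃ k, r = ⟨k, ρ k⟩} =
        invInterClosure (KAClosure {r : Rels A | ∃ k, r = ⟨k, ρ k⟩})) ∧
    (KAClosure {r : Rels A | ∃ k, r = ⟨k, ρ k⟩} ⊂
        sInvG (AutR (KAClosure {r : Rels A | ∃ k, r = ⟨k, ρ k⟩}))) := by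
  classical
  let Q : ℕ → Set (Rels A) := fun m => {r : Rels A | ∃ k, k < m ∧ r = ⟨k, ρ k⟩}
  let Qi : Set (Rels A) := {r : Rels A | ∃ k, r = ⟨k, ρ k⟩}
  have hQmono : ∀ m m', m ≤ m' → Q m ⊆ Q m' := by
    rintro m m' h _ ⟨k, hk, rfl⟩
    exact ⟨k, hk.trans_le h, rfl⟩
  have hQsub : ∀ m, Q m ⊆ Qi := by
    rintro m _ ⟨k, hk, rfl⟩
    exact ⟨k, rfl⟩
  have P1 : ∀ m, KAClosure (Q m) = sInvG (AutR (Q m)) := by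
    intro m
    refine Set.Subset.antisymm (KA_min (fun r hr g hg => hg r hr) (sInvG_krasner _)) ?_
    rintro ⟨n, σ⟩ hσ
    obtain ⟨φ, rfl⟩ := definable_of_inv ρ m (hhom m) n σ hσ
    exact KA_krasner (Q m) m (fun i => (i : ℕ)) (fun i => ρ i)
      (fun i => KA_sub _ ⟨i, i.2, rfl⟩) n φ
  have hmono : ∀ m m', m ≤ m' → KAClosure (Q m) ⊆ KAClosure (Q m') :=
    fun m m' h => KA_mono (hQmono m m' h)
  have P2 : KAClosure Qi = ⋃ m : ℕ, KAClosure (Q m) := by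
    refine Set.Subset.antisymm (KA_min ?_ ?_) (Set.iUnion_subset fun m => KA_mono (hQsub m))
    · rintro _ ⟨k, rfl⟩
      exact Set.mem_iUnion.2 ⟨k + 1, KA_sub _ ⟨k, Nat.lt_succ_self k, rfl⟩⟩
    · intro n k τ hτ m φ
      choose s hs using fun i => Set.mem_iUnion.1 (hτ i)
      refine Set.mem_iUnion.2 ⟨Finset.univ.sup s, KA_krasner _ n k τ (fun i => ?_) m φ⟩
      exact hmono _ _ (Finset.le_sup (f := s) (Finset.mem_univ i)) (hs i)
  have hfin : ∀ n, {S : Set (Fin (n + 1) → A) | (⟨n, S⟩ : Rels A) ∈ KAClosure Qi}.Finite := by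
    intro n
    refine (finite_definable ρ hcat (n + 1)).subset ?_
    intro S hS
    have hS' : (⟨n, S⟩ : Rels A) ∈ KAClosure Qi := hS
    rw [P2] at hS'
    obtain ⟨m, hm⟩ := Set.mem_iUnion.1 hS'
    rw [P1] at hm
    obtain ⟨φ, rfl⟩ := definable_of_inv ρ m (hhom m) n S hm
    exact logicalOp_Lrel ρ m (n + 1) φ
  have hInv : InvClosed (KAClosure Qi) := by
    intro n k m F hF τ hτ
    rw [P2] at hτ ⊢
    choose s hs using fun i => Set.mem_iUnion.1 (hτ i)
    refine Set.mem_iUnion.2 ⟨Finset.univ.sup s, ?_⟩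
    rw [P1]
    refine sInvG_inv _ n k m F hF τ (fun i => ?_)
    rw [← P1]
    exact hmono _ _ (Finset.le_sup (f := s) (Finset.mem_univ i)) (hs i)
  have hInter : InterClosed (KAClosure Qi) := by
    have main : ∀ (m : ℕ) (W : Set (Set (Fin (m + 1) → A))),
        (∀ τ ∈ W, (⟨m, τ⟩ : Rels A) ∈ KAClosure Qi) →
          (⟨m, ⋂₀ W⟩ : Rels A) ∈ KAClosure Qi := by
      intro n W hW
      have hWf : W.Finite := (hfin n).subset hW
      have hW2 : ∀ τ : W, ∃ m, (⟨n, τ.1⟩ : Rels A) ∈ KAClosure (Q m) := by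
        intro τ
        have := hW τ.1 τ.2
        rw [P2] at this
        exact Set.mem_iUnion.1 this
      choose s hs using hW2
      haveI := hWf.fintype
      rw [P2]
      refine Set.mem_iUnion.2 ⟨Finset.univ.sup s, ?_⟩
      rw [P1]
      intro g hg
      refine (permImage_eq_iff _ _).2 fun a => ?_
      show (⇑g ∘ a ∈ ⋂₀ W) ↔ (a ∈ ⋂₀ W)
      rw [Set.mem_sInter, Set.mem_sInter]
      refine forall_congr' fun τ => forall_congr' fun hτ => ?_
      have h1 := hmono _ _ (Finset.le_sup (f := s) (Finset.mem_univ ⟨τ, hτ⟩)) (hs ⟨τ, hτ⟩)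
      rw [P1] at h1
      exact (permImage_eq_iff g τ).1 (h1 g hg) a
    refine ⟨fun m => ?_, main⟩
    have := main m ∅ (fun _ h => h.elim)
    rwa [Set.sInter_empty] at this
  refine ⟨P1, P2, ?_, ?_⟩
  · refine Set.Subset.antisymm (Set.subset_sInter fun _ h => h.1) ?_
    exact Set.sInter_subset_of_mem ⟨subset_rfl, hInv, hInter⟩
  · refine ⟨fun r hr g hg => hg r hr, fun hsub => ?_⟩
    have hall : ∀ S : Set (Fin (0 + 1) → A), (⟨0, S⟩ : Rels A) ∈ KAClosure Qi := by
      intro S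
      refine hsub ?_
      intro g hg
      have hg1 : g ∈ AutR Qi := fun r hr => hg r (KA_sub _ hr)
      rw [show AutR Qi = {1} from hrigid] at hg1
      have hg2 : g = 1 := hg1
      subst hg2
      exact (permImage_eq_iff _ _).2 fun a => Iff.rfl
    have huniv := hfin 0
    have : {S : Set (Fin (0 + 1) → A) | (⟨0, S⟩ : Rels A) ∈ KAClosure Qi} = Set.univ :=
      Set.eq_univ_of_forall hall
    rw [this] at huniv
    exact Set.infinite_univ huniv
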